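/- Let d ≥ 1, let X ⊆ ℤ^d be finite and lattice-convex, let Y ⊆ ℤ^d \ X be finite, and let ε > 0. Let ℐ be the family of all subsets of Y that are ε-separable from X. For every Y-hiding set H for X and every z ∈ ℝ_+^ℐ satisfying Σ_{I ∈ ℐ, y ∈ I} z_I ≥ 1 for all y ∈ Y, one has Σ_{I ∈ ℐ} z_I ≥ |H|. In particular, the optimal value v*_CG of the LP relaxation of the column generation model satisfies v*_CG ≥ H(X,Y). -/

import Mathlib

open Classical

/-- The canonical embedding of integer points into `ℝ^d`. -/
def toR {d : ℕ} (x : Fin d → ℤ) : Fin d → ℝ := fun j => (x j : ℝ)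

/-- A finite set `X ⊆ ℤ^d` is lattice-convex if `X = conv(X) ∩ ℤ^d`. -/
def LatticeConvex {d : ℕ} (X : Finset (Fin d → ℤ)) : Prop :=
  ∀ z : Fin d → ℤ, toR z ∈ convexHull ℝ (toR '' ↑X) → z ∈ X

/-- `I` is `ε`-separable from `X`. -/
def EpsSep {d : ℕ} (ε : ℝ) (X : Finset (Fin d → ℤ)) (I : Set (Fin d → ℤ)) : Prop :=
  ∃ (a : Fin d → ℝ) (β : ℝ), (∀ j, |a j| ≤ 1) ∧
    (∀ x ∈ X, ∑ j, a j * (x j : ℝ) ≤ β) ∧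
    (∀ y ∈ I, β + ε ≤ ∑ j, a j * (y j : ℝ))

/-- `H` is a hiding set for `X`: `H ⊆ (aff(X) ∩ ℤ^d) \ X` and for any distinct
`y₁, y₂ ∈ H`, the segment `conv{y₁,y₂}` meets `conv(X)`. -/
def IsHidingSet {d : ℕ} (X : Finset (Fin d → ℤ)) (H : Set (Fin d → ℤ)) : Prop :=
  (∀ h ∈ H, toR h ∈ affineSpan ℝ (toR '' ↑X) ∧ h ∉ X) ∧
  (∀ y₁ ∈ H, ∀ y₂ ∈ H, y₁ ≠ y₂ →
    (convexHull ℝ {toR y₁, toR y₂} ∩ convexHull ℝ (toR '' ↑X)).Nonempty)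

/-- `H(X,Y)`: the maximum cardinality of a `Y`-hiding set for `X`. -/
noncomputable def maxHiding {d : ℕ} (X Y : Finset (Fin d → ℤ)) : ℕ :=
  sSup {n : ℕ | ∃ H : Finset (Fin d → ℤ), ↑H ⊆ (↑Y : Set (Fin d → ℤ)) ∧
    IsHidingSet X ↑H ∧ H.card = n}

/-- `ℐ`: the family of all subsets of `Y` that are `ε`-separable from `X`. -/
noncomputable def sepFamily {d : ℕ} (ε : ℝ) (X Y : Finset (Fin d → ℤ)) :
    Finset (Finset (Fin d → ℤ)) :=
  Y.powerset.filter (fun I => EpsSep ε X ↑I)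

/-- Feasibility for the LP relaxation of the column generation model. -/
noncomputable def CGFeas {d : ℕ} (ε : ℝ) (X Y : Finset (Fin d → ℤ))
    (z : Finset (Fin d → ℤ) → ℝ) : Prop :=
  (∀ I, 0 ≤ z I) ∧
  (∀ I, z I ≠ 0 → I ∈ sepFamily ε X Y) ∧
  (∀ y ∈ Y, 1 ≤ ∑ I ∈ (sepFamily ε X Y).filter (fun I => y ∈ I), z I)

/-- Objective value of the column generation model. -/
noncomputable def cgObj {d : ℕ} (ε : ℝ) (X Y : Finset (Fin d → ℤ))
    (z : Finset (Fin d → ℤ) → ℝ) : ℝ :=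
  ∑ I ∈ sepFamily ε X Y, z I

/-- A separable set contains at most one element of a hiding set. -/
lemma hiding_unique {d : ℕ} {ε : ℝ} (hε : 0 < ε) {X : Finset (Fin d → ℤ)}
    {I H : Set (Fin d → ℤ)} (hI : EpsSep ε X I) (hH : IsHidingSet X H)
    {y₁ y₂ : Fin d → ℤ} (h1 : y₁ ∈ H) (h2 : y₂ ∈ H) (i1 : y₁ ∈ I) (i2 : y₂ ∈ I) :
    y₁ = y₂ := by
  by_contra hne
  obtain ⟨p, hp, hpX⟩ := hH.2 y₁ h1 y₂ h2 hne
  obtain ⟨a, β, -, hx, hy⟩ := hI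
  have hlin : IsLinearMap ℝ (fun w : Fin d → ℝ => ∑ j, a j * w j) := by
    constructor
    · intro u v
      simp [mul_add, Finset.sum_add_distrib]
    · intro c u
      simp only [Pi.smul_apply, smul_eq_mul, Finset.mul_sum]
      exact Finset.sum_congr rfl fun j _ => by ring
  have hle : p ∈ {w : Fin d → ℝ | ∑ j, a j * w j ≤ β} := by
    refine convexHull_min ?_ (convex_halfSpace_le hlin β) hpX
    rintro _ ⟨x, hxX, rfl⟩
    exact hx x hxX
  have hge : p ∈ {w : Fin d → ℝ | β + ε ≤ ∑ j, a j * w j} := by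
    refine convexHull_min ?_ (convex_halfSpace_ge hlin (β + ε)) hp
    rintro w (rfl | rfl)
    · exact hy y₁ i1
    · exact hy y₂ i2
  simp only [Set.mem_setOf_eq] at hle hge
  linarith

lemma hiding_bound {d : ℕ} (X Y : Finset (Fin d → ℤ)) (ε : ℝ) (hε : 0 < ε)
    (H : Finset (Fin d → ℤ)) (hHY : ↑H ⊆ (↑Y : Set (Fin d → ℤ))) (hH : IsHidingSet X ↑H)
    (z : Finset (Fin d → ℤ) → ℝ) (hz : CGFeas ε X Y z) :
    (H.card : ℝ) ≤ cgObj ε X Y z := by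
  obtain ⟨h0, -, hc⟩ := hz
  calc (H.card : ℝ) = ∑ y ∈ H, (1 : ℝ) := by simp
    _ ≤ ∑ y ∈ H, ∑ I ∈ (sepFamily ε X Y).filter (fun I => y ∈ I), z I :=
        Finset.sum_le_sum fun y hy => hc y (hHY hy)
    _ = ∑ I ∈ sepFamily ε X Y, ∑ y ∈ H.filter (fun y => y ∈ I), z I := by
        simp only [Finset.sum_filter]
        exact Finset.sum_comm
    _ ≤ cgObj ε X Y z := by
        unfold cgObj
        refine Finset.sum_le_sum fun I hI => ?_
        have hsep : EpsSep ε X ↑I := (Finset.mem_filter.mp hI).2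
        have hcard : (H.filter (fun y => y ∈ I)).card ≤ 1 := by
          refine Finset.card_le_one.mpr fun u hu v hv => ?_
          rw [Finset.mem_filter] at hu hv
          exact hiding_unique hε hsep hH hu.1 hv.1 hu.2 hv.2
        rw [Finset.sum_const, nsmul_eq_mul]
        have : ((H.filter (fun y => y ∈ I)).card : ℝ) ≤ 1 := by exact_mod_cast hcard
        exact mul_le_of_le_one_left (h0 I) this

/-- every feasible CG solution has objective value at least the
cardinality of any `Y`-hiding set; in particular `v*_CG ≥ H(X,Y)`. -/
theorem stmt_5 {d : ℕ} (hd : 1 ≤ d) (X Y : Finset (Fin d → ℤ))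
    (hX : LatticeConvex X) (hXY : ∀ y ∈ Y, y ∉ X)
    (ε : ℝ) (hε : 0 < ε) :
    (∀ H : Finset (Fin d → ℤ), ↑H ⊆ (↑Y : Set (Fin d → ℤ)) → IsHidingSet X ↑H →
      ∀ z : Finset (Fin d → ℤ) → ℝ, CGFeas ε X Y z →
        (H.card : ℝ) ≤ cgObj ε X Y z) ∧
    ((∃ z : Finset (Fin d → ℤ) → ℝ, CGFeas ε X Y z) →
      (maxHiding X Y : ℝ) ≤
        sInf {v : ℝ | ∃ z : Finset (Fin d → ℤ) → ℝ,
          CGFeas ε X Y z ∧ v = cgObj ε X Y z}) := by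
  refine ⟨fun H hHY hH z hz => hiding_bound X Y ε hε H hHY hH z hz, ?_⟩
  rintro ⟨z₀, hz₀⟩
  have hmem : maxHiding X Y ∈ {n : ℕ | ∃ H : Finset (Fin d → ℤ),
      ↑H ⊆ (↑Y : Set (Fin d → ℤ)) ∧ IsHidingSet X ↑H ∧ H.card = n} := by
    refine Nat.sSup_mem ⟨0, ∅, by simp, ?_, by simp⟩ ⟨Y.card, ?_⟩
    · constructor <;> simp
    · rintro n ⟨H, hHY, -, rfl⟩
      exact Finset.card_le_card (Finset.coe_subset.mp hHY)
  obtain ⟨H, hHY, hH, hcard⟩ := hmem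
  rw [← hcard]
  refine le_csInf ⟨_, z₀, hz₀, rfl⟩ ?_
  rintro v ⟨z, hz, rfl⟩
  exact hiding_bound X Y ε hε H hHY hH z hz
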